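/- arXiv:1408.5194 — 2 statements merged into one kernel-verified Lean document; each statement's English description precedes it below -/
import Mathlib

section
/- Let K be a function field of transcendence degree d ≥ 2 over an algebraically closed field k, and let v be a divisorial-type valuation of K. Then the unit group U_v is generated, as a subgroup of K^×, by the union of the groups F^×, where F ranges over the relatively algebraically closed subextensions of K|k with trdeg(F|k) = 1 satisfying F^× ⊆ U_v. -/
/-! Common definitions: mod-ℓ Milnor K-theory, K^×/(K^×)^ℓ, Ω_K, relative algebraic
closure, transcendence degree predicates, discrete valuations, etc. -/

noncomputable section

open scoped TensorProduct

universe u v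

/-- The `n`-fold tensor power (over `ℤ`) of the multiplicative group `Kˣ`,
written additively. -/
abbrev MilnorPre (n : ℕ) (K : Type*) [Field K] : Type _ :=
  PiTensorProduct ℤ (fun _ : Fin n => Additive Kˣ)

/-- The submodule of Steinberg relations: generated by all `a₁ ⊗ ⋯ ⊗ aₙ`
with `aᵢ + aⱼ = 1` for some `i < j`. -/
def SteinbergRel (n : ℕ) (K : Type*) [Field K] : Submodule ℤ (MilnorPre n K) :=
  Submodule.span ℤ
    {x | ∃ a : Fin n → Kˣ,
      (∃ i j : Fin n, i < j ∧ ((a i : K) + (a j : K) = 1)) ∧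
        x = PiTensorProduct.tprod ℤ (fun i => Additive.ofMul (a i))}

/-- The `n`-th Milnor K-group `K^M_n(K)`: the quotient of the `n`-fold tensor
power of `K^×` by the Steinberg relations. -/
abbrev MilnorK (n : ℕ) (K : Type*) [Field K] : Type _ :=
  MilnorPre n K ⧸ SteinbergRel n K

/-- The mod-`ℓ` Milnor K-group `k^M_n(K) = K^M_n(K)/ℓ`. -/
abbrev MilnorKMod (ℓ n : ℕ) (K : Type*) [Field K] : Type _ :=
  MilnorK n K ⧸ LinearMap.range ((ℓ : ℤ) • (LinearMap.id : MilnorK n K →ₗ[ℤ] MilnorK n K))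

/-- The symbol `{a₁, …, aₙ}` in `k^M_n(K)`. -/
def milnorSymbol (ℓ : ℕ) {n : ℕ} {K : Type*} [Field K] (a : Fin n → Kˣ) :
    MilnorKMod ℓ n K :=
  Submodule.Quotient.mk (Submodule.Quotient.mk
    (PiTensorProduct.tprod ℤ (fun i => Additive.ofMul (a i))))

/-- `k^M_1(K) = K^×/(K^×)^ℓ`, written multiplicatively. -/
abbrev K1 (ℓ : ℕ) (K : Type*) [Field K] : Type _ :=
  Kˣ ⧸ (powMonoidHom ℓ : Kˣ →* Kˣ).range

/-- The projection `K^× → K^×/(K^×)^ℓ`. -/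
def K1proj (ℓ : ℕ) (K : Type*) [Field K] : Kˣ →* K1 ℓ K :=
  QuotientGroup.mk' _

/-- The subgroup of `Kˣ` consisting of the units lying in an intermediate field `L`. -/
def fieldUnits {k K : Type*} [Field k] [Field K] [Algebra k K]
    (L : IntermediateField k K) : Subgroup Kˣ where
  carrier := {x : Kˣ | (x : K) ∈ L}
  one_mem' := by simpa using one_mem L
  mul_mem' := by
    intro a b ha hb
    simpa using mul_mem ha hb
  inv_mem' := by
    intro a ha
    simpa using inv_mem (show (a : K) ∈ L from ha)

/-- `Ω_K(L)`: the image of `L^×` in `K^×/(K^×)^ℓ`. -/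
def Omega (ℓ : ℕ) {k K : Type*} [Field k] [Field K] [Algebra k K]
    (L : IntermediateField k K) : Subgroup (K1 ℓ K) :=
  (fieldUnits L).map (K1proj ℓ K)

/-- A subextension `L` of `K|k` is relatively algebraically closed in `K` if every
element of `K` algebraic over `L` lies in `L`. -/
def RelAlgClosed {k K : Type*} [Field k] [Field K] [Algebra k K]
    (L : IntermediateField k K) : Prop :=
  ∀ x : K, IsAlgebraic L x → x ∈ L

/-- `K` is a function field over `k`: a finitely generated field extension. -/
def IsFunctionField (k K : Type*) [Field k] [Field K] [Algebra k K] : Prop :=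
  ∃ s : Finset K, IntermediateField.adjoin k (s : Set K) = ⊤

/-- `trdeg(K|k) = d`: there is a transcendence basis indexed by `Fin d`. -/
def HasTrdeg (k : Type*) (K : Type*) [Field k] [Field K] [Algebra k K] (d : ℕ) : Prop :=
  ∃ x : Fin d → K, IsTranscendenceBasis k x

/-- `trdeg(K|k) ≥ m`: there are `m` algebraically independent elements. -/
def TrdegGe (k : Type*) (K : Type*) [Field k] [Field K] [Algebra k K] (m : ℕ) : Prop :=
  ∃ x : Fin m → K, AlgebraicIndependent k x

/-- `dim^M_K(S) ≥ d` for a subset `S ⊆ k^M_1(K)`: there are `s₁, …, s_d ∈ S` with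
`{s₁, …, s_d} ≠ 0` in `k^M_d(K)`. -/
def dimMge (ℓ : ℕ) {K : Type*} [Field K] (S : Set (K1 ℓ K)) (d : ℕ) : Prop :=
  ∃ a : Fin d → Kˣ, (∀ i, K1proj ℓ K (a i) ∈ S) ∧ milnorSymbol ℓ a ≠ 0

/-- `dim^M_K(S) = r`. -/
def dimMeq (ℓ : ℕ) {K : Type*} [Field K] (S : Set (K1 ℓ K)) (r : ℕ) : Prop :=
  dimMge ℓ S r ∧ ¬ dimMge ℓ S (r + 1)

/-- `t` is a general element of `K` over `k`: `t ∉ k` and `k(t)` is relatively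
algebraically closed in `K`. -/
def IsGeneralElement (k : Type*) {K : Type*} [Field k] [Field K] [Algebra k K] (t : K) : Prop :=
  t ∉ (⊥ : IntermediateField k K) ∧ RelAlgClosed (IntermediateField.adjoin k {t})

/-- A rational subgroup of `k^M_1(K)`: `Ω_K(k(t))` for a general element `t`. -/
def IsRationalSubgroup (ℓ : ℕ) (k : Type*) {K : Type*} [Field k] [Field K] [Algebra k K]
    (A : Subgroup (K1 ℓ K)) : Prop :=
  ∃ t : K, IsGeneralElement k t ∧ A = Omega ℓ (IntermediateField.adjoin k {t})

/-- `𝔊^r(K|k)`: the subgroups `Ω_K(L)` for `L` relatively algebraically closed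
in `K` of transcendence degree `r` over `k`. -/
def GSet (ℓ : ℕ) (k : Type*) {K : Type*} [Field k] [Field K] [Algebra k K] (r : ℕ) :
    Set (Subgroup (K1 ℓ K)) :=
  {A | ∃ L : IntermediateField k K, RelAlgClosed L ∧ HasTrdeg k L r ∧ A = Omega ℓ L}

/-- `𝔐^1(K)`: subgroups maximal among the subgroups `B` of `k^M_1(K)`
with `dim^M_K(B) = 1`. -/
def M1Set (ℓ : ℕ) (K : Type*) [Field K] : Set (Subgroup (K1 ℓ K)) :=
  {A | dimMeq ℓ (A : Set (K1 ℓ K)) 1 ∧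
    ∀ B : Subgroup (K1 ℓ K), dimMeq ℓ (B : Set (K1 ℓ K)) 1 → A ≤ B → B = A}

/-- Condition (a) and (b) of the maximality characterization of `𝔊^r`:
`B` is generated by rational subgroups and `dim^M_K(B) = r`. -/
def SpannedByRatWithDim (ℓ : ℕ) (k : Type*) {K : Type*} [Field k] [Field K] [Algebra k K]
    (r : ℕ) (B : Subgroup (K1 ℓ K)) : Prop :=
  (∃ S : Set (Subgroup (K1 ℓ K)), (∀ T ∈ S, IsRationalSubgroup ℓ k T) ∧ B = sSup S) ∧
    dimMeq ℓ (B : Set (K1 ℓ K)) r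

/-- A discrete valuation of a field `F`: a surjective homomorphism `F^× → ℤ`
satisfying the ultrametric inequality. -/
structure DiscreteValuation (F : Type*) [Field F] where
  v : Fˣ → ℤ
  map_mul' : ∀ x y : Fˣ, v (x * y) = v x + v y
  surjective' : Function.Surjective v
  min_le' : ∀ x y z : Fˣ, (x : F) + (y : F) = (z : F) → min (v x) (v y) ≤ v z

lemma DiscreteValuation.v_one {F : Type*} [Field F] (w : DiscreteValuation F) : w.v 1 = 0 := by
  have h := w.map_mul' 1 1
  simp only [mul_one] at h
  omega

/-- A discrete valuation of `F` is trivial on the base field `k`. -/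
def DiscreteValuation.TrivialOn (k : Type*) {F : Type*} [Field k] [Field F] [Algebra k F]
    (w : DiscreteValuation F) : Prop :=
  ∀ (c : k) (hc : algebraMap k F c ≠ 0), w.v (Units.mk0 _ hc) = 0

/-- The unit group `U_w ⊆ F^×` of a discrete valuation. -/
def DiscreteValuation.units {F : Type*} [Field F] (w : DiscreteValuation F) : Subgroup Fˣ where
  carrier := {x : Fˣ | w.v x = 0}
  one_mem' := w.v_one
  mul_mem' := by
    intro a b ha hb
    have h := w.map_mul' a b
    simp only [Set.mem_setOf_eq] at ha hb ⊢
    omega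
  inv_mem' := by
    intro a ha
    have h := w.map_mul' a a⁻¹
    rw [mul_inv_cancel] at h
    have h1 := w.v_one
    simp only [Set.mem_setOf_eq] at ha ⊢
    omega

/-- `𝔘_v`: the image of the unit group `U_v` in `K^×/(K^×)^ℓ`. -/
def DiscreteValuation.unitsImage (ℓ : ℕ) {F : Type*} [Field F] (w : DiscreteValuation F) :
    Subgroup (K1 ℓ F) :=
  w.units.map (K1proj ℓ F)

/-- For a discrete valuation `w` of an intermediate field `F` of `K|k`, the image of
the unit group `U_w` in `K^×/(K^×)^ℓ`. -/
def unitsImageIn (ℓ : ℕ) {k K : Type*} [Field k] [Field K] [Algebra k K]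
    (F : IntermediateField k K) (w : DiscreteValuation F) : Subgroup (K1 ℓ K) :=
  (w.units.map (Units.map (algebraMap F K).toMonoidHom)).map (K1proj ℓ K)

/-- The residue field of `v` has transcendence degree `≥ m` over `k`: there are
`v`-units `x₁, …, x_m` whose residues are algebraically independent over `k`,
expressed by saying that every nonzero polynomial over `k` evaluated at the `xᵢ`
is a unit of value `0`. -/
def DiscreteValuation.ResidueTrdegGe (k : Type*) {K : Type*} [Field k] [Field K] [Algebra k K]
    (v : DiscreteValuation K) (m : ℕ) : Prop :=
  ∃ x : Fin m → Kˣ, (∀ i, v.v (x i) = 0) ∧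
    ∀ P : MvPolynomial (Fin m) k, P ≠ 0 →
      ∃ u : Kˣ, (u : K) = MvPolynomial.aeval (fun i => ((x i : K))) P ∧ v.v u = 0

/-- A divisorial-type valuation of `K|k` (where `d = trdeg(K|k)`): a discrete valuation
trivial on `k` whose residue field has transcendence degree exactly `d - 1` over `k`. -/
def IsDivisorialType (k : Type*) {K : Type*} [Field k] [Field K] [Algebra k K] (d : ℕ)
    (v : DiscreteValuation K) : Prop :=
  v.TrivialOn k ∧ v.ResidueTrdegGe k (d - 1) ∧ ¬ v.ResidueTrdegGe k d

/-- `Δ_A`: the set of subgroups `A ⊓ 𝔘_v`, for `v` ranging over the divisorial-type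
valuations of `K` with `A ⊄ 𝔘_v`. -/
def DeltaA (ℓ : ℕ) (k : Type*) {K : Type*} [Field k] [Field K] [Algebra k K] (d : ℕ)
    (A : Subgroup (K1 ℓ K)) : Set (Subgroup (K1 ℓ K)) :=
  {T | ∃ v : DiscreteValuation K, IsDivisorialType k d v ∧
    ¬ A ≤ v.unitsImage ℓ ∧ T = A ⊓ v.unitsImage ℓ}

/-- A good rational subgroup: a rational subgroup `A = Ω_K(k(t))` such that for every
discrete valuation `w` of `k(t)` trivial on `k`, the image of `U_w` in `K^×/(K^×)^ℓ`
belongs to `Δ_A`. -/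
def IsGoodRationalSubgroup (ℓ : ℕ) (k : Type*) {K : Type*} [Field k] [Field K] [Algebra k K]
    (d : ℕ) (A : Subgroup (K1 ℓ K)) : Prop :=
  ∃ t : K, IsGeneralElement k t ∧ A = Omega ℓ (IntermediateField.adjoin k {t}) ∧
    ∀ w : DiscreteValuation (IntermediateField.adjoin k {t}), w.TrivialOn k →
      unitsImageIn ℓ (IntermediateField.adjoin k {t}) w ∈ DeltaA ℓ k d A

/-- A very general element: a general element `t` such that `Ω_K(k(t))` is a good
rational subgroup. -/
def IsVeryGeneral (ℓ : ℕ) (k : Type*) {K : Type*} [Field k] [Field K] [Algebra k K]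
    (d : ℕ) (t : K) : Prop :=
  IsGeneralElement k t ∧ IsGoodRationalSubgroup ℓ k d (Omega ℓ (IntermediateField.adjoin k {t}))

/-- `x` is separable in `K`: in characteristic `p > 0`, `x` is not a `p`-th power;
in characteristic `0` every element is separable. -/
def IsSeparableIn (K : Type*) [Field K] (x : K) : Prop :=
  ∀ p : ℕ, p.Prime → CharP K p → ¬ ∃ y : K, y ^ p = x

/-- A perfect closure of `K`: a perfect field which is a purely inseparable
extension of `K`. -/
structure PerfectClosureOf (K : Type u) [Field K] : Type (u + 1) where
  carrier : Type u
  [fieldInst : Field carrier]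
  [algebraInst : Algebra K carrier]
  purelyInseparable : IsPurelyInseparable K carrier
  perfect : PerfectField carrier

attribute [instance] PerfectClosureOf.fieldInst PerfectClosureOf.algebraInst

/-- A group isomorphism `φ : k^M_1(K) → k^M_1(L)` is induced by a field isomorphism
`σ : K^i → L^i` of the perfect closures, via the canonical identifications
`k^M_1(K) ≅ k^M_1(K^i)` and `k^M_1(L) ≅ k^M_1(L^i)`. -/
def InducesOnK1 (ℓ : ℕ) {K : Type u} {L : Type v} [Field K] [Field L]
    (PK : PerfectClosureOf K) (PL : PerfectClosureOf L)
    (σ : PK.carrier ≃+* PL.carrier) (φ : K1 ℓ K ≃* K1 ℓ L) : Prop :=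
  ∀ (x : Kˣ) (y : Lˣ),
    (φ (K1proj ℓ K x) = K1proj ℓ L y ↔
      ∃ z : (PL.carrier)ˣ,
        Units.map σ.toRingHom.toMonoidHom
            (Units.map (algebraMap K PK.carrier).toMonoidHom x) =
          Units.map (algebraMap L PL.carrier).toMonoidHom y * z ^ ℓ)

/-- `φ : k^M_1(K) → k^M_1(L)` is compatible with `k^M_2`: `φ ⊗ φ` descends, along the
multiplication maps, to an isomorphism `k^M_2(K) → k^M_2(L)`; equivalently, there is an
additive isomorphism `k^M_2(K) ≃ k^M_2(L)` carrying `{a, b}` to `{a', b'}` whenever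
`φ` carries the class of `a` (resp. `b`) to the class of `a'` (resp. `b'`). -/
def CompatWithK2 (ℓ : ℕ) {K L : Type*} [Field K] [Field L] (φ : K1 ℓ K ≃* K1 ℓ L) : Prop :=
  ∃ ψ : MilnorKMod ℓ 2 K ≃+ MilnorKMod ℓ 2 L,
    ∀ (a b : Kˣ) (a' b' : Lˣ),
      φ (K1proj ℓ K a) = K1proj ℓ L a' → φ (K1proj ℓ K b) = K1proj ℓ L b' →
        ψ (milnorSymbol ℓ ![a, b]) = milnorSymbol ℓ ![a', b']

/-- `φ : k^M_1(K) → k^M_1(L)` is compatible with `𝔊^1_rat`: it maps rational subgroups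
bijectively onto rational subgroups. -/
def CompatWithRat (ℓ : ℕ) (k : Type*) (l : Type*) {K L : Type*}
    [Field k] [Field K] [Algebra k K] [Field l] [Field L] [Algebra l L]
    (φ : K1 ℓ K ≃* K1 ℓ L) : Prop :=
  (∀ A : Subgroup (K1 ℓ K), IsRationalSubgroup ℓ k A →
     IsRationalSubgroup ℓ l (A.map φ.toMonoidHom)) ∧
  (∀ B : Subgroup (K1 ℓ L), IsRationalSubgroup ℓ l B →
     ∃ A : Subgroup (K1 ℓ K), IsRationalSubgroup ℓ k A ∧ A.map φ.toMonoidHom = B)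

/-- Two isomorphisms of perfect closures differ by a power of the Frobenius
(in characteristic `0`, they are equal). -/
def FrobTwistEquiv {Ki Li : Type*} [Field Ki] [Field Li] (σ σ' : Ki ≃+* Li) : Prop :=
  σ = σ' ∨ ∃ p : ℕ, p.Prime ∧ CharP Ki p ∧
    ((∃ n : ℕ, ∀ x, σ' x = σ (x ^ p ^ n)) ∨ (∃ n : ℕ, ∀ x, σ x = σ' (x ^ p ^ n)))

namespace DiscreteValuation

variable {F : Type*} [Field F] (w : DiscreteValuation F)

lemma v_inv (x : Fˣ) : w.v x⁻¹ = -w.v x := by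
  have h := w.map_mul' x x⁻¹
  rw [mul_inv_cancel, w.v_one] at h
  omega

lemma v_neg_one : w.v (-1) = 0 := by
  have h := w.map_mul' (-1) (-1)
  rw [neg_mul_neg, one_mul, w.v_one] at h
  omega

lemma v_neg (x : Fˣ) : w.v (-x) = w.v x := by
  rw [← neg_one_mul, w.map_mul', w.v_neg_one, zero_add]

/-- A unit of value `0` plus an element which is zero or of positive value is a unit of
value `0`. -/
lemma exists_add_eq_of_pos (a : Fˣ) (ha : w.v a = 0) (b : F)
    (hb : ∀ u : Fˣ, (u : F) = b → 0 < w.v u) : ∃ u : Fˣ, (u : F) = a + b ∧ w.v u = 0 := by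
  by_cases hb0 : b = 0
  · exact ⟨a, by simp [hb0], ha⟩
  have hbv := hb (Units.mk0 b hb0) rfl
  have hne : (a : F) + b ≠ 0 := by
    intro h
    have := hb (-a) (by rw [Units.val_neg]; linear_combination -h)
    rw [w.v_neg] at this
    omega
  refine ⟨Units.mk0 _ hne, rfl, ?_⟩
  have h1 := w.min_le' a (Units.mk0 b hb0) (Units.mk0 _ hne) rfl
  have h2 := w.min_le' (Units.mk0 _ hne) (-Units.mk0 b hb0) a (by simp)
  rw [w.v_neg] at h2
  omega

/-- The valuation ring of a discrete valuation. -/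
def valuationSubring : ValuationSubring F where
  carrier := {x | ∀ u : Fˣ, (u : F) = x → 0 ≤ w.v u}
  one_mem' u hu := by rw [show u = 1 from Units.ext hu, w.v_one]
  zero_mem' u hu := (u.ne_zero hu).elim
  mul_mem' := by
    intro a b ha hb u hu
    have hab : a * b ≠ 0 := hu ▸ u.ne_zero
    obtain rfl : u = Units.mk0 a (left_ne_zero_of_mul hab) *
        Units.mk0 b (right_ne_zero_of_mul hab) := Units.ext hu
    rw [w.map_mul']
    exact add_nonneg (ha _ rfl) (hb _ rfl)
  add_mem' := by
    intro a b ha hb u hu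
    by_cases ha0 : a = 0
    · exact hb u (by simpa [ha0] using hu)
    by_cases hb0 : b = 0
    · exact ha u (by simpa [hb0] using hu)
    exact (le_min (ha (Units.mk0 a ha0) rfl) (hb (Units.mk0 b hb0) rfl)).trans
      (w.min_le' _ _ u hu.symm)
  neg_mem' := by
    intro a ha u hu
    rw [← w.v_neg]
    exact ha (-u) (by simp [hu])
  mem_or_inv_mem' x := by
    by_cases hx : x = 0
    · exact Or.inl fun u hu => (u.ne_zero (hu.trans hx)).elim
    rcases le_total 0 (w.v (Units.mk0 x hx)) with h | h
    · refine Or.inl fun u hu => ?_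
      rwa [show u = Units.mk0 x hx from Units.ext hu]
    · refine Or.inr fun u hu => ?_
      rw [show u = (Units.mk0 x hx)⁻¹ from Units.ext (by simpa using hu), w.v_inv]
      omega

section Algebraic

variable {k K : Type*} [Field k] [Field K] [Algebra k K] (v : DiscreteValuation K)

lemma nonneg_of_isAlgebraic {L : IntermediateField k K} (hL : fieldUnits L ≤ v.units)
    (x : Kˣ) (hx : IsAlgebraic L (x : K)) : 0 ≤ v.v x := by
  have hle : ∀ y : L, (y : K) ∈ v.valuationSubring := by
    intro y u hu
    exact (hL (show (u : K) ∈ L from hu ▸ y.2) : v.v u = 0).ge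
  let f : L →+* v.valuationSubring := (algebraMap L K).codRestrict v.valuationSubring.toSubring hle
  obtain ⟨p, hp, hpx⟩ := hx.isIntegral
  have hint : IsIntegral v.valuationSubring (x : K) := by
    refine ⟨p.map f, hp.map f, ?_⟩
    rw [Polynomial.eval₂_map]
    exact hpx
  obtain ⟨y, hy⟩ := IsIntegrallyClosed.isIntegral_iff.mp hint
  exact y.2 x hy.symm

/-- If all nonzero elements of `L` have value `0`, then so have all nonzero elements algebraic
over `L`. -/
lemma eq_zero_of_isAlgebraic {L : IntermediateField k K} (hL : fieldUnits L ≤ v.units)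
    (x : Kˣ) (hx : IsAlgebraic L (x : K)) : v.v x = 0 := by
  have h1 := v.nonneg_of_isAlgebraic hL x hx
  have h2 := v.nonneg_of_isAlgebraic hL x⁻¹ (by simpa using hx.inv)
  rw [v.v_inv] at h2
  omega

/-- The residue of `x` is not in `k`: every `x - c` with `c ∈ k` has value `0`. For `k`
algebraically closed, this says that the residue of `x` is transcendental over `k`. -/
def ResidueNotInBase (k : Type*) {K : Type*} [Field k] [Field K] [Algebra k K]
    (v : DiscreteValuation K) (x : K) : Prop :=
  ∀ c : k, ∃ u : Kˣ, (u : K) = x - algebraMap k K c ∧ v.v u = 0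

variable {v}

lemma TrivialOn.exists_unit (hv : v.TrivialOn k) {c : k} (hc : c ≠ 0) :
    ∃ u : Kˣ, (u : K) = algebraMap k K c ∧ v.v u = 0 :=
  ⟨_, rfl, hv c (by simpa using hc)⟩

lemma ResidueNotInBase.exists_unit_aeval [IsAlgClosed k] (hv : v.TrivialOn k) {x : K}
    (hx : v.ResidueNotInBase k x) {p : Polynomial k} (hp : p ≠ 0) :
    ∃ u ∈ v.units, (u : K) = Polynomial.aeval x p := by
  suffices Polynomial.aeval x p ∈ v.units.toSubmonoid.map (Units.coeHom K) by
    simpa [Submonoid.mem_map] using this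
  rw [(IsAlgClosed.splits p).eq_prod_roots, map_mul, Polynomial.aeval_C, map_multiset_prod,
    Multiset.map_map]
  refine mul_mem ?_ (Submonoid.multiset_prod_mem _ _ ?_)
  · obtain ⟨u, hu, h0⟩ := hv.exists_unit (Polynomial.leadingCoeff_ne_zero.mpr hp)
    exact ⟨u, h0, hu⟩
  · intro y hy
    obtain ⟨c, -, rfl⟩ := Multiset.mem_map.mp hy
    obtain ⟨u, hu, h0⟩ := hx c
    exact ⟨u, h0, by simpa using hu⟩

lemma ResidueNotInBase.transcendental [IsAlgClosed k] (hv : v.TrivialOn k) {x : K}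
    (hx : v.ResidueNotInBase k x) : Transcendental k x := by
  rw [transcendental_iff]
  intro p hp
  by_contra h
  obtain ⟨u, -, hu⟩ := hx.exists_unit_aeval hv h
  exact u.ne_zero (hu.trans hp)

lemma ResidueNotInBase.fieldUnits_adjoin_le [IsAlgClosed k] (hv : v.TrivialOn k) {x : K}
    (hx : v.ResidueNotInBase k x) :
    fieldUnits (IntermediateField.adjoin k {x}) ≤ v.units := by
  intro y hy
  obtain ⟨r, s, hrs⟩ := (IntermediateField.mem_adjoin_simple_iff k _).mp hy
  have hr : r ≠ 0 := by
    rintro rfl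
    simp at hrs
  have hs : s ≠ 0 := by
    rintro rfl
    simp at hrs
  obtain ⟨a, ha, har⟩ := hx.exists_unit_aeval hv hr
  obtain ⟨b, hb, hbs⟩ := hx.exists_unit_aeval hv hs
  rw [show y = a / b from Units.ext (by rw [hrs, Units.val_div_eq_div_val, har, hbs])]
  exact div_mem ha hb

/-- If the residue of `u` is not in `k` but that of the unit `x` is, then the residue of `x * u`
is not in `k`. -/
lemma ResidueNotInBase.mul_of_not (hv : v.TrivialOn k) {u x : Kˣ}
    (hu : v.ResidueNotInBase k (u : K)) (hx0 : v.v x = 0)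
    (hx : ¬ v.ResidueNotInBase k (x : K)) : v.ResidueNotInBase k ((x * u : Kˣ) : K) := by
  have hu0 : v.v u = 0 := by
    obtain ⟨u', hu', h0⟩ := hu 0
    rwa [show u' = u from Units.ext (by simpa using hu')] at h0
  obtain ⟨c, hc⟩ := not_forall.mp hx
  have hc0 : c ≠ 0 := by
    rintro rfl
    exact hc ⟨x, by simp, hx0⟩
  obtain ⟨c', hc', hc'0⟩ := hv.exists_unit hc0
  have hpos : ∀ y : Kˣ, (y : K) = x - algebraMap k K c → 0 < v.v y := by
    intro y hy
    have h1 := v.min_le' x (-c') y (by rw [hy, Units.val_neg, hc', sub_eq_add_neg])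
    rw [v.v_neg] at h1
    have h2 : v.v y ≠ 0 := fun h => hc ⟨y, hy, h⟩
    omega
  intro a
  obtain ⟨y, hy, hy0⟩ := hu (a / c)
  obtain ⟨z, hz, hz0⟩ := v.exists_add_eq_of_pos (c' * y) (by rw [v.map_mul', hc'0, hy0, add_zero])
    ((x - algebraMap k K c) * u) (by
      intro t ht
      have := hpos (t * u⁻¹) (by rw [Units.val_mul, ht]; simp)
      rwa [v.map_mul', v.v_inv, hu0, neg_zero, add_zero] at this)
  refine ⟨z, ?_, hz0⟩
  have hcK : algebraMap k K c ≠ 0 := by simpa using hc0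
  rw [hz, Units.val_mul, Units.val_mul, hc', hy, map_div₀]
  field_simp
  ring

lemma ResidueTrdegGe.exists_residueNotInBase {m : ℕ} (hm : 0 < m) (h : v.ResidueTrdegGe k m) :
    ∃ u : Kˣ, v.ResidueNotInBase k (u : K) := by
  obtain ⟨x, -, hx⟩ := h
  refine ⟨x ⟨0, hm⟩, fun c => ?_⟩
  obtain ⟨u, hu, h0⟩ := hx (MvPolynomial.X ⟨0, hm⟩ - MvPolynomial.C c) (by
    intro h
    have := congrArg (MvPolynomial.eval fun _ => c + 1) h
    simp at this)
  exact ⟨u, by simpa using hu, h0⟩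

end Algebraic

end DiscreteValuation

section RelAlgClosure

variable {k K : Type*} [Field k] [Field K] [Algebra k K]

/-- The relative algebraic closure in `K` of an intermediate field `L` of `K|k`. -/
def relAlgClosure (L : IntermediateField k K) : IntermediateField k K :=
  (algebraicClosure L K).restrictScalars k

lemma mem_relAlgClosure {L : IntermediateField k K} {x : K} :
    x ∈ relAlgClosure L ↔ IsAlgebraic L x :=
  mem_algebraicClosure_iff

lemma relAlgClosed_relAlgClosure (L : IntermediateField k K) :
    RelAlgClosed (relAlgClosure L) := by
  intro x hx
  have hx' : IsAlgebraic (algebraicClosure L K) x := hx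
  exact mem_relAlgClosure.mpr (hx'.restrictScalars L)

lemma HasTrdeg.relAlgClosure {L : IntermediateField k K} {d : ℕ} (h : HasTrdeg k L d) :
    HasTrdeg k (relAlgClosure L) d := by
  obtain ⟨y, hy⟩ := h
  have : FaithfulSMul L (algebraicClosure L K) :=
    (faithfulSMul_iff_algebraMap_injective _ _).mpr
      fun _ _ hab => (algebraMap L K).injective
        (congrArg (Subtype.val : algebraicClosure L K → K) hab)
  exact ⟨_, hy.algebraMap_comp (A := algebraicClosure L K)⟩

lemma hasTrdeg_one_adjoin_simple {x : K} (hx : Transcendental k x) :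
    HasTrdeg k (IntermediateField.adjoin k {x}) 1 := by
  have h1 : IsTranscendenceBasis k fun _ : Fin 1 => (Polynomial.X : Polynomial k) :=
    .polynomial (Fin 1) k
  have : Algebra.IsAlgebraic (Polynomial k) (RatFunc k) :=
    IsLocalization.isAlgebraic _ (nonZeroDivisors (Polynomial k))
  have h2 := h1.algebraMap_comp (A := RatFunc k)
  exact ⟨_, (RatFunc.algEquivOfTranscendental x hx).isTranscendenceBasis h2⟩

end RelAlgClosure

theorem statement_11 (k K : Type*) [Field k] [Field K] [Algebra k K]
    [IsAlgClosed k] (hK : IsFunctionField k K)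
    (d : ℕ) (hd : HasTrdeg k K d) (h2 : 2 ≤ d)
    (v : DiscreteValuation K) (hv : IsDivisorialType k d v) :
    v.units = ⨆ F ∈ {F : IntermediateField k K |
        RelAlgClosed F ∧ HasTrdeg k F 1 ∧ fieldUnits F ≤ v.units}, fieldUnits F := by
  refine le_antisymm ?_ (iSup₂_le fun F hF => hF.2.2)
  obtain ⟨hk, hres, -⟩ := hv
  set S := ⨆ F ∈ {F : IntermediateField k K |
    RelAlgClosed F ∧ HasTrdeg k F 1 ∧ fieldUnits F ≤ v.units}, fieldUnits F
  have key : ∀ x : Kˣ, v.ResidueNotInBase k (x : K) → x ∈ S := by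
    intro x hx
    let L := IntermediateField.adjoin k {(x : K)}
    have hxL : (x : K) ∈ relAlgClosure L := mem_relAlgClosure.mpr
      (isAlgebraic_algebraMap (⟨x, IntermediateField.mem_adjoin_simple_self k _⟩ : L))
    refine (le_iSup₂_of_le (f := fun F _ => fieldUnits F) (relAlgClosure L)
      ⟨relAlgClosed_relAlgClosure L,
        (hasTrdeg_one_adjoin_simple (hx.transcendental hk)).relAlgClosure, fun y hy => ?_⟩ le_rfl) hxL
    exact v.eq_zero_of_isAlgebraic (hx.fieldUnits_adjoin_le hk) y (mem_relAlgClosure.mp hy)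
  obtain ⟨u, hu⟩ := hres.exists_residueNotInBase (by omega)
  intro x hx
  by_cases h : v.ResidueNotInBase k (x : K)
  · exact key x h
  · rw [← mul_inv_cancel_right x u]
    exact mul_mem (key _ (hu.mul_of_not hk hx h)) (inv_mem (key u hu))

end
end

section
/- Let ℓ be a prime and let K be a function field over an algebraically closed field k with char k ≠ ℓ and trdeg(K|k) ≥ 5. Let A be a good rational subgroup of k^M_1(K) = K^×/(K^×)^ℓ and let Φ be a group automorphism of K^×/(K^×)^ℓ such that Φ(A) = A and Φ(T) = T for every T ∈ Δ_A. Then there exists ε ∈ (ℤ/ℓ)^× such that Φ(a) = a^ε for all a ∈ A. -/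
/-! Common definitions: mod-ℓ Milnor K-theory, K^×/(K^×)^ℓ, Ω_K, relative algebraic
closure, transcendence degree predicates, discrete valuations, etc. -/

noncomputable section

open scoped TensorProduct

universe u v

section

open Polynomial IsDedekindDomain

/-- An automorphism respecting the mod-`ℓ` divisor decomposition of `G` (with respect to divisor
maps `w` and degree map `δ`) is a power map modulo `ℓ`. -/
lemma exists_power_of_map_ker_eq {ι G Q : Type*} [CommGroup G] [CommGroup Q] [Nonempty ι] {ℓ : ℕ}
    (hℓ : ℓ.Prime) (π : G →* Q) (hπ : ∀ x, π x = 1 ↔ ∃ y, y ^ ℓ = x)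
    (w : ι → G →* Multiplicative ℤ) (δ : G →* Multiplicative ℤ) (l : ι → G)
    (hw : ∀ a, w a (l a) = .ofAdd 1) (hw' : ∀ a b, a ≠ b → w b (l a) = 1)
    (hδ : ∀ a, δ (l a) = .ofAdd (-1))
    (hG : ∀ g, ∃ (y : G) (m : ι →₀ ℤ), g = y ^ ℓ * m.prod fun a n => l a ^ n)
    (Φ : Q ≃* Q) (hΦ : π.range.map Φ.toMonoidHom = π.range)
    (hΦw : ∀ a, ((w a).ker.map π).map Φ.toMonoidHom = (w a).ker.map π)
    (hΦδ : (δ.ker.map π).map Φ.toMonoidHom = δ.ker.map π) :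
    ∃ ε : (ZMod ℓ)ˣ, ∀ q ∈ π.range, Φ q = q ^ (ε : ZMod ℓ).val := by
  have key : ∀ (v : G →* Multiplicative ℤ), (v.ker.map π).map Φ.toMonoidHom = v.ker.map π →
      ∀ x g, v x = 1 → Φ (π x) = π g → (ℓ : ℤ) ∣ (v g).toAdd := by
    intro v hv x g hx hxg
    have h1 : Φ (π x) ∈ v.ker.map π := hv ▸ ⟨π x, ⟨x, hx, rfl⟩, rfl⟩
    obtain ⟨u, hu, hug⟩ := h1
    have h2 : π (g / u) = 1 := by rw [_root_.map_div, hug, hxg, div_self']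
    obtain ⟨y, hy⟩ := (hπ _).1 h2
    have h3 : g = y ^ ℓ * u := by rw [hy]; simp
    have hu' : v u = 1 := hu
    rw [h3, map_mul, map_pow, hu', mul_one, toAdd_pow, nsmul_eq_mul]
    exact dvd_mul_right _ _
  have hπℓ : ∀ x, π x ^ ℓ = 1 := fun x => by
    rw [← map_pow]; exact (hπ _).2 ⟨x, rfl⟩
  have hdvd : ∀ (x : G) (n : ℤ), (ℓ : ℤ) ∣ n → π x ^ n = 1 := by
    rintro x _ ⟨c, rfl⟩
    rw [zpow_mul, zpow_natCast, hπℓ, one_zpow]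
  have hprod : ∀ (m : ι →₀ ℤ) (b : ι), w b (m.prod fun a n => l a ^ n) = .ofAdd (m b) := by
    intro m b
    rw [map_finsuppProd, Finsupp.prod_eq_single b]
    · rw [map_zpow, hw, ← ofAdd_zsmul, smul_eq_mul, mul_one]
    · intro a _ hab
      rw [map_zpow, hw' a b hab, one_zpow]
    · intro _; simp
  have hlin : ∀ a, ∃ n : ℤ, Φ (π (l a)) = π (l a) ^ n := by
    intro a
    have h1 : Φ (π (l a)) ∈ π.range := hΦ ▸ ⟨π (l a), ⟨l a, rfl⟩, rfl⟩
    obtain ⟨g, hg⟩ := h1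
    obtain ⟨y, m, rfl⟩ := hG g
    refine ⟨m a, ?_⟩
    rw [← hg, map_mul, map_pow, hπℓ, one_mul, map_finsuppProd, Finsupp.prod_eq_single a]
    · rw [map_zpow]
    · intro b _ hba
      rw [map_zpow]
      refine hdvd _ _ ?_
      have h2 := key (w b) (hΦw b) (l a) _ (hw' a b hba.symm) hg.symm
      rw [map_mul, map_pow, hprod, toAdd_mul, toAdd_pow, nsmul_eq_mul, toAdd_ofAdd] at h2
      exact (dvd_add_right (dvd_mul_right _ _)).1 h2
    · intro _; simp
  choose n hn using hlin
  have hconst : ∀ a b, π (l b) ^ n b = π (l b) ^ n a := by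
    intro a b
    have h1 : Φ (π (l a / l b)) = π (l a ^ n a / l b ^ n b) := by
      simp only [_root_.map_div, hn, map_zpow]
    have h2 := key δ hΦδ _ _ (by rw [_root_.map_div, hδ, hδ, div_self']) h1
    simp only [_root_.map_div, map_zpow, hδ, toAdd_div, toAdd_zpow, toAdd_ofAdd, smul_eq_mul] at h2
    rw [← div_eq_one, div_eq_mul_inv, ← zpow_sub]
    exact hdvd _ _ (by convert h2 using 1; ring)
  obtain ⟨i⟩ := ‹Nonempty ι›
  have : Fact ℓ.Prime := ⟨hℓ⟩
  have hi0 : (n i : ZMod ℓ) ≠ 0 := by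
    intro hi
    rw [ZMod.intCast_zmod_eq_zero_iff_dvd] at hi
    have h1 := hn i
    rw [hdvd _ _ hi, map_eq_one_iff Φ Φ.injective] at h1
    obtain ⟨y, hy⟩ := (hπ _).1 h1
    have h2 := congrArg Multiplicative.toAdd (hw i)
    rw [← hy, map_pow, toAdd_pow, nsmul_eq_mul, toAdd_ofAdd] at h2
    have h3 : (ℓ : ℤ) ∣ 1 := ⟨_, h2.symm⟩
    exact hℓ.one_lt.ne' (by exact_mod_cast Int.eq_one_of_dvd_one (by positivity) h3)
  have hpow : ∀ g, Φ (π g) = π g ^ n i := by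
    intro g
    obtain ⟨y, m, rfl⟩ := hG g
    rw [map_mul, map_pow, hπℓ, one_mul, map_finsuppProd, map_finsuppProd, Finsupp.prod,
      Finsupp.prod, ← Finset.prod_zpow]
    refine Finset.prod_congr rfl fun a _ => ?_
    rw [map_zpow, map_zpow, hn, hconst i a, zpow_comm]
  refine ⟨Units.mk0 _ hi0, ?_⟩
  rintro _ ⟨g, rfl⟩
  have hval : (ℓ : ℤ) ∣ n i - ((n i : ZMod ℓ).val : ℤ) := by
    rw [← ZMod.intCast_zmod_eq_zero_iff_dvd]
    simp
  rw [hpow, Units.val_mk0, ← zpow_natCast, ← div_eq_one, div_eq_mul_inv, ← zpow_sub]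
  exact hdvd _ _ hval

/-- The discrete valuation attached to a valuation with values in `ℤᵐ⁰` having a uniformizer. -/
def DiscreteValuation.ofValuation {F : Type*} [Field F]
    (v : Valuation F (WithZero (Multiplicative ℤ))) (π : Fˣ)
    (hπ : v π = WithZero.exp (-1)) : DiscreteValuation F where
  v x := -WithZero.log (v x)
  map_mul' x y := by
    rw [Units.val_mul, map_mul, WithZero.log_mul (by simp) (by simp)]
    ring
  surjective' n := ⟨π ^ n, by simp [hπ]⟩
  min_le' x y z h := by
    have hx : v (x : F) ≠ 0 := by simp
    have hy : v (y : F) ≠ 0 := by simp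
    have hz : v (z : F) ≠ 0 := by simp
    have := v.map_add x y
    rw [h] at this
    rcases le_max_iff.1 this with h | h
    · have := (WithZero.log_le_log hz hx).2 h
      omega
    · have := (WithZero.log_le_log hz hy).2 h
      omega

/-- A discrete valuation as a group homomorphism. -/
def DiscreteValuation.toHom {F : Type*} [Field F] (w : DiscreteValuation F) :
    Fˣ →* Multiplicative ℤ where
  toFun x := .ofAdd (w.v x)
  map_one' := by rw [w.v_one]; rfl
  map_mul' x y := by rw [w.map_mul']; rfl

lemma DiscreteValuation.ker_toHom {F : Type*} [Field F] (w : DiscreteValuation F) :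
    w.toHom.ker = w.units := by
  ext x
  exact Iff.rfl

section RationalFunctionField

variable {k F : Type*} [Field k] [Field F] [Algebra k F] (e : RatFunc k ≃ₐ[k] F)

/-- The linear factor `t - a` as a unit of a rational function field with generator `t`. -/
def linearFactor (a : k) : Fˣ :=
  Units.mk0 (e (algebraMap k[X] (RatFunc k) (X - C a))) (by
    rw [map_ne_zero_iff e e.injective, map_ne_zero_iff _ (RatFunc.algebraMap_injective k)]
    exact X_sub_C_ne_zero a)

/-- The place `t = a` of the polynomial ring. -/
def placeAt (a : k) : HeightOneSpectrum k[X] where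
  asIdeal := Ideal.span {X - C a}
  isPrime := (Ideal.span_singleton_prime (X_sub_C_ne_zero a)).2 (prime_X_sub_C a)
  ne_bot := by simpa using X_sub_C_ne_zero a

lemma placeAt_valuation_self (a : k) :
    (placeAt a).valuation (RatFunc k) (algebraMap k[X] (RatFunc k) (X - C a)) =
      WithZero.exp (-1) := by
  rw [HeightOneSpectrum.valuation_of_algebraMap]
  exact (placeAt a).intValuation_singleton (X_sub_C_ne_zero a) rfl

lemma placeAt_valuation_of_eval_ne_zero (a : k) {p : k[X]} (hp : p.eval a ≠ 0) :
    (placeAt a).valuation (RatFunc k) (algebraMap k[X] (RatFunc k) p) = 1 := by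
  rw [HeightOneSpectrum.valuation_eq_one_iff_notMem]
  simpa [placeAt, Ideal.mem_span_singleton, dvd_iff_isRoot] using hp

/-- The discrete valuation of a rational function field at the point `t = a`. -/
def pointValuation (a : k) : DiscreteValuation F :=
  .ofValuation (((placeAt a).valuation (RatFunc k)).comap (e.symm : F →+* RatFunc k))
    (linearFactor e a) (by simpa [linearFactor] using placeAt_valuation_self a)

open Classical in
/-- The discrete valuation of a rational function field at infinity. -/
def infinityValuation : DiscreteValuation F :=
  .ofValuation ((RatFunc.inftyValuation k).comap (e.symm : F →+* RatFunc k))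
    (Units.mk0 (e RatFunc.X) (by simp [RatFunc.X_ne_zero]))⁻¹ (by
      simp only [Units.val_inv_eq_inv_val, map_inv₀, Units.val_mk0]
      simp [RatFunc.inftyValuation.X, WithZero.exp_neg])

lemma pointValuation_trivialOn (a : k) : (pointValuation e a).TrivialOn k := by
  intro c hc
  have hc' : c ≠ 0 := by rintro rfl; simp at hc
  have := placeAt_valuation_of_eval_ne_zero a (p := C c) (by simpa using hc')
  simpa [pointValuation, DiscreteValuation.ofValuation, RatFunc.algebraMap_eq_C] using
    congrArg WithZero.log this

lemma infinityValuation_trivialOn : (infinityValuation e).TrivialOn k := by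
  classical
  intro c hc
  simp [infinityValuation, DiscreteValuation.ofValuation, RatFunc.algebraMap_eq_C,
    RatFunc.inftyValuation_apply, RatFunc.inftyValuation_of_nonzero]

lemma pointValuation_linearFactor_self (a : k) :
    (pointValuation e a).toHom (linearFactor e a) = .ofAdd 1 := by
  change Multiplicative.ofAdd (-WithZero.log ((placeAt a).valuation (RatFunc k)
    (e.symm (e (algebraMap k[X] (RatFunc k) (X - C a)))))) = _
  rw [e.symm_apply_apply, placeAt_valuation_self, WithZero.log_exp, neg_neg]

lemma pointValuation_linearFactor_of_ne {a b : k} (h : a ≠ b) :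
    (pointValuation e b).toHom (linearFactor e a) = 1 := by
  change Multiplicative.ofAdd (-WithZero.log ((placeAt b).valuation (RatFunc k)
    (e.symm (e (algebraMap k[X] (RatFunc k) (X - C a)))))) = _
  rw [e.symm_apply_apply, placeAt_valuation_of_eval_ne_zero b
    (by simpa [sub_eq_zero] using h.symm), WithZero.log_one, neg_zero, ofAdd_zero]

open Classical in
lemma infinityValuation_linearFactor (a : k) :
    (infinityValuation e).toHom (linearFactor e a) = .ofAdd (-1) := by
  change Multiplicative.ofAdd (-WithZero.log (RatFunc.inftyValuation k
    (e.symm (e (algebraMap k[X] (RatFunc k) (X - C a)))))) = _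
  rw [e.symm_apply_apply, RatFunc.inftyValuation_apply, RatFunc.inftyValuation_of_nonzero,
    WithZero.log_exp, RatFunc.intDegree_polynomial, natDegree_X_sub_C, Nat.cast_one]
  rw [map_ne_zero_iff _ (RatFunc.algebraMap_injective k)]
  exact X_sub_C_ne_zero a

lemma exists_eq_pow_mul_prod_linearFactor [IsAlgClosed k] {ℓ : ℕ} (hℓ : 0 < ℓ) (f : Fˣ) :
    ∃ (y : Fˣ) (m : k →₀ ℤ), f = y ^ ℓ * m.prod fun a n => linearFactor e a ^ n := by
  set S : Subgroup Fˣ := (powMonoidHom ℓ : Fˣ →* Fˣ).range ⊔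
    (Subgroup.closure (Set.range (linearFactor e)))
  have hpoly : ∀ (p : k[X]) (u : Fˣ), (u : F) = e (algebraMap k[X] (RatFunc k) p) → u ∈ S := by
    intro p u hu
    have hp0 : p ≠ 0 := by
      rintro rfl
      simp at hu
    obtain ⟨c, hc⟩ := IsAlgClosed.exists_pow_nat_eq p.leadingCoeff hℓ
    have hc0 : c ≠ 0 := by
      rintro rfl
      rw [zero_pow hℓ.ne'] at hc
      exact hp0 (leadingCoeff_eq_zero.1 hc.symm)
    have huv : u = (Units.mk0 (algebraMap k F c) (by simpa using hc0)) ^ ℓ *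
        (p.roots.map (linearFactor e)).prod := by
      ext
      rw [hu]
      nth_rw 1 [(IsAlgClosed.splits p).eq_prod_roots]
      rw [Units.val_mul, Units.val_pow_eq_pow_val, Units.val_mk0, ← map_pow, hc,
        map_mul, map_mul, map_multiset_prod, map_multiset_prod, ← Units.coeHom_apply,
        map_multiset_prod, Multiset.map_map, Multiset.map_map, Multiset.map_map]
      congr 1
      rw [RatFunc.algebraMap_C, ← RatFunc.algebraMap_eq_C, e.commutes]
    rw [huv]
    refine mul_mem (Subgroup.mem_sup_left ⟨_, rfl⟩) (Subgroup.mem_sup_right ?_)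
    refine Subgroup.multiset_prod_mem _ _ fun x hx => ?_
    obtain ⟨a, _, rfl⟩ := Multiset.mem_map.1 hx
    exact Subgroup.subset_closure ⟨a, rfl⟩
  have hf : f ∈ S := by
    have hnum : e (algebraMap k[X] (RatFunc k) (e.symm (f : F)).num) ≠ 0 := by
      simp
    have hden : e (algebraMap k[X] (RatFunc k) (e.symm (f : F)).denom) ≠ 0 := by
      simpa using RatFunc.denom_ne_zero _
    have : f = Units.mk0 _ hnum / Units.mk0 _ hden := by
      ext
      rw [Units.val_div_eq_div_val, Units.val_mk0, Units.val_mk0, ← _root_.map_div₀,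
        RatFunc.num_div_denom, e.apply_symm_apply]
    rw [this]
    exact div_mem (hpoly _ _ rfl) (hpoly _ _ rfl)
  obtain ⟨_, ⟨y, rfl⟩, z, hz, rfl⟩ := Subgroup.mem_sup.1 hf
  obtain ⟨m, rfl⟩ := Subgroup.exists_finsupp_of_mem_closure_range _ _ hz
  exact ⟨y, m, rfl⟩

end RationalFunctionField

section Inclusion

variable (ℓ : ℕ) {k K : Type*} [Field k] [Field K] [Algebra k K] (L : IntermediateField k K)

/-- The homomorphism `L^× → K^×/(K^×)^ℓ` for a subextension `L` of `K|k`. -/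
def unitsToK1 : Lˣ →* K1 ℓ K :=
  (K1proj ℓ K).comp (Units.map (algebraMap L K).toMonoidHom)

lemma range_unitsToK1 : (unitsToK1 ℓ L).range = Omega ℓ L := by
  ext q
  constructor
  · rintro ⟨x, rfl⟩
    exact ⟨_, (x : L).2, rfl⟩
  · rintro ⟨x, hx, rfl⟩
    exact ⟨Units.mk0 ⟨x, hx⟩ fun h => x.ne_zero (congrArg Subtype.val h),
      congrArg (K1proj ℓ K) (Units.ext rfl)⟩

lemma map_ker_unitsToK1 (w : DiscreteValuation L) :
    w.toHom.ker.map (unitsToK1 ℓ L) = unitsImageIn ℓ L w := by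
  rw [unitsImageIn, Subgroup.map_map, w.ker_toHom, unitsToK1]

variable {ℓ L} in
lemma RelAlgClosed.unitsToK1_eq_one_iff (hL : RelAlgClosed L) (hℓ : 0 < ℓ) (x : Lˣ) :
    unitsToK1 ℓ L x = 1 ↔ ∃ y, y ^ ℓ = x := by
  constructor
  · intro hx
    obtain ⟨g, hg⟩ := (QuotientGroup.eq_one_iff _).1 hx
    have hg' : (g : K) ^ ℓ = (x : L) := congrArg Units.val hg
    have hgL : (g : K) ∈ L := hL _ <| by
      refine IsAlgebraic.of_pow hℓ ?_
      rw [hg']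
      exact isAlgebraic_algebraMap (x : L)
    refine ⟨Units.mk0 ⟨g, hgL⟩ fun h => g.ne_zero (congrArg Subtype.val h), ?_⟩
    ext
    exact hg'
  · rintro ⟨y, rfl⟩
    exact (QuotientGroup.eq_one_iff _).2 ⟨Units.map (algebraMap L K).toMonoidHom y, by simp⟩

end Inclusion

lemma transcendental_of_notMem_bot {k K : Type*} [Field k] [Field K] [Algebra k K]
    [IsAlgClosed k] {t : K} (ht : t ∉ (⊥ : IntermediateField k K)) : Transcendental k t := by
  intro halg
  refine ht ?_
  obtain ⟨c, hc⟩ := (IsAlgClosed.algebraMap_bijective_of_isIntegral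
    (k := k) (K := algebraicClosure k K)).2 ⟨t, halg.isIntegral⟩
  exact IntermediateField.mem_bot.2 ⟨c, congrArg Subtype.val hc⟩

end

theorem statement_14 (ℓ : ℕ) (hℓ : ℓ.Prime) (k K : Type*) [Field k] [Field K] [Algebra k K]
    [IsAlgClosed k] (hchar : ringChar k ≠ ℓ) (hK : IsFunctionField k K)
    (d : ℕ) (hd : HasTrdeg k K d) (h5 : 5 ≤ d)
    (A : Subgroup (K1 ℓ K)) (hA : IsGoodRationalSubgroup ℓ k d A)
    (Φ : K1 ℓ K ≃* K1 ℓ K)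
    (hAfix : A.map Φ.toMonoidHom = A)
    (hTfix : ∀ T ∈ DeltaA ℓ k d A, Subgroup.map Φ.toMonoidHom T = T) :
    ∃ ε : (ZMod ℓ)ˣ, ∀ a ∈ A, Φ a = a ^ ((ε : ZMod ℓ)).val := by
  obtain ⟨t, ⟨ht, hrel⟩, rfl, hgood⟩ := hA
  let e := RatFunc.algEquivOfTranscendental t (transcendental_of_notMem_bot ht)
  have hker : ∀ w : DiscreteValuation (IntermediateField.adjoin k {t}), w.TrivialOn k →
      (w.toHom.ker.map (unitsToK1 ℓ _)).map Φ.toMonoidHom = w.toHom.ker.map (unitsToK1 ℓ _) := by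
    intro w hw
    rw [map_ker_unitsToK1]
    exact hTfix _ (hgood w hw)
  rw [← range_unitsToK1] at hAfix ⊢
  exact exists_power_of_map_ker_eq (ι := k) (Q := K1 ℓ K) hℓ
    (unitsToK1 ℓ (IntermediateField.adjoin k {t})) (hrel.unitsToK1_eq_one_iff hℓ.pos)
    (fun a => (pointValuation e a).toHom) (infinityValuation e).toHom (linearFactor e)
    (pointValuation_linearFactor_self e) (fun _ _ => pointValuation_linearFactor_of_ne e)
    (infinityValuation_linearFactor e) (exists_eq_pow_mul_prod_linearFactor e hℓ.pos)
    Φ hAfix (fun a => hker _ (pointValuation_trivialOn e a))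
    (hker _ (infinityValuation_trivialOn e))

end
end
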